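/- arXiv:2112.11712 — 5 statements merged into one kernel-verified Lean document; each statement's English description precedes it below -/
import Mathlib

section
/- Let G be a simple graph on n vertices and let A ∈ S(G). Then A has the strong spectral property (SSP) if and only if S^cl(G) + {KᵀA + AK : K an n×n real skew-symmetric matrix} = Sym_n(ℝ), i.e., every n×n real symmetric matrix can be written as B + KᵀA + AK with B ∈ S^cl(G) and K real skew-symmetric. -/
open Matrix Polynomial

/-- `A` belongs to `S(G)`: symmetric, with off-diagonal nonzero pattern given by `G`. -/
def sMem {n : ℕ} (G : SimpleGraph (Fin n)) (A : Matrix (Fin n) (Fin n) ℝ) : Prop :=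
  A.IsSymm ∧ ∀ i j, i ≠ j → (A i j ≠ 0 ↔ G.Adj i j)

/-- `B` belongs to `S^cl(G)`: symmetric, with off-diagonal zeros on non-edges. -/
def sclMem {n : ℕ} (G : SimpleGraph (Fin n)) (B : Matrix (Fin n) (Fin n) ℝ) : Prop :=
  B.IsSymm ∧ ∀ i j, i ≠ j → ¬ G.Adj i j → B i j = 0

/-- The strong spectral property. -/
def HasSSP {n : ℕ} (A : Matrix (Fin n) (Fin n) ℝ) : Prop :=
  ∀ X : Matrix (Fin n) (Fin n) ℝ, X.IsSymm →
    (∀ i j, A i j * X i j = 0) → (∀ i, X i i = 0) → A * X = X * A → X = 0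

/-- A matrix outside a submodule of matrices is separated from it by a trace pairing. -/
theorem exists_trace_mul_ne_zero_of_notMem {m : Type*} [Fintype m] [DecidableEq m]
    {W : Submodule ℝ (Matrix m m ℝ)} {M : Matrix m m ℝ} (hM : M ∉ W) :
    ∃ Y : Matrix m m ℝ, (∀ N ∈ W, (Y * N).trace = 0) ∧ (Y * M).trace ≠ 0 := by
  obtain ⟨f, hfM, hfW⟩ := Submodule.exists_le_ker_of_notMem hM
  have hf : ∀ N, ((Matrix.of fun i j => f (Matrix.single j i 1)) * N).trace = f N := by
    intro N
    conv_rhs => rw [Matrix.matrix_eq_sum_single N]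
    simp only [Matrix.trace, Matrix.diag_apply, Matrix.mul_apply, Matrix.of_apply, map_sum]
    rw [Finset.sum_comm]
    refine Finset.sum_congr rfl fun i _ => Finset.sum_congr rfl fun j _ => ?_
    rw [show Matrix.single i j (N i j) = N i j • Matrix.single i j (1 : ℝ) by simp, map_smul,
      smul_eq_mul, mul_comm]
  exact ⟨_, fun N hN => (hf N).trans (hfW hN), by rwa [hf]⟩

/-- A real matrix with vanishing Frobenius norm is zero. -/
theorem eq_zero_of_trace_transpose_mul_self {m : Type*} [Fintype m] {C : Matrix m m ℝ}
    (h : (Cᵀ * C).trace = 0) : C = 0 := by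
  rw [← Matrix.conjTranspose_eq_transpose_of_trivial] at h
  exact Matrix.trace_conjTranspose_mul_self_eq_zero_iff.mp h

/-- The pairing of `X` with `KᵀA + AK` is the pairing of a commutator with `K`. -/
theorem trace_mul_tangent {m : Type*} [Fintype m] {A X K : Matrix m m ℝ} (hK : Kᵀ = -K) :
    (X * (Kᵀ * A + A * K)).trace = ((X * A - A * X) * K).trace := by
  rw [hK, Matrix.mul_add, Matrix.sub_mul, Matrix.trace_add, Matrix.trace_sub, Matrix.neg_mul,
    Matrix.mul_neg, Matrix.trace_neg, ← Matrix.mul_assoc X K A, Matrix.trace_mul_comm (X * K) A,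
    ← Matrix.mul_assoc, ← Matrix.mul_assoc]
  ring

/-- The subspace `S^cl(G) + {KᵀA + AK : K skew-symmetric}`. -/
def sclAddTangent {n : ℕ} (G : SimpleGraph (Fin n)) (A : Matrix (Fin n) (Fin n) ℝ) :
    Submodule ℝ (Matrix (Fin n) (Fin n) ℝ) where
  carrier := {M | ∃ B K : Matrix (Fin n) (Fin n) ℝ,
    sclMem G B ∧ Kᵀ = -K ∧ M = B + Kᵀ * A + A * K}
  zero_mem' := ⟨0, 0, ⟨Matrix.isSymm_zero, fun _ _ _ _ => rfl⟩, by simp, by simp⟩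
  add_mem' := by
    rintro _ _ ⟨B, K, hB, hK, rfl⟩ ⟨B', K', hB', hK', rfl⟩
    refine ⟨B + B', K + K', ⟨hB.1.add hB'.1, fun i j hij h => ?_⟩, ?_, ?_⟩
    · simp [hB.2 i j hij h, hB'.2 i j hij h]
    · rw [Matrix.transpose_add, hK, hK', neg_add]
    · rw [Matrix.transpose_add, Matrix.add_mul, Matrix.mul_add]
      abel
  smul_mem' := by
    rintro c _ ⟨B, K, hB, hK, rfl⟩
    refine ⟨c • B, c • K, ⟨hB.1.smul c, fun i j hij h => ?_⟩, ?_, ?_⟩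
    · simp [hB.2 i j hij h]
    · rw [Matrix.transpose_smul, hK, smul_neg]
    · simp [smul_add]

theorem isSymm_of_mem_sclAddTangent {n : ℕ} {G : SimpleGraph (Fin n)}
    {A N : Matrix (Fin n) (Fin n) ℝ} (hA : A.IsSymm) (hN : N ∈ sclAddTangent G A) :
    N.IsSymm := by
  obtain ⟨B, K, hB, hK, rfl⟩ := hN
  rw [Matrix.IsSymm]
  simp only [Matrix.transpose_add, Matrix.transpose_mul, Matrix.transpose_transpose, hA.eq,
    hB.1.eq]
  abel

theorem trace_add_transpose_mul {m : Type*} [Fintype m] {Y N : Matrix m m ℝ} (hN : N.IsSymm) :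
    ((Y + Yᵀ) * N).trace = 2 * (Y * N).trace := by
  have h : (Yᵀ * N).trace = (Y * N).trace := by
    rw [← Matrix.trace_transpose, Matrix.transpose_mul, Matrix.transpose_transpose, hN.eq,
      Matrix.trace_mul_comm]
  rw [Matrix.add_mul, Matrix.trace_add, h, two_mul]

/-- Symmetric matrices orthogonal to `S^cl(G)` vanish on the diagonal and on the edges. -/
theorem apply_eq_zero_of_trace_mul_scl {n : ℕ} {G : SimpleGraph (Fin n)}
    {X : Matrix (Fin n) (Fin n) ℝ} (hX : X.IsSymm)
    (h : ∀ B, sclMem G B → (X * B).trace = 0) {i j : Fin n} (hij : i = j ∨ G.Adj i j) :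
    X i j = 0 := by
  have hB : sclMem G (Matrix.single i j 1 + Matrix.single j i 1) := by
    refine ⟨?_, fun k l hkl hG => ?_⟩
    · rw [Matrix.IsSymm, Matrix.transpose_add, Matrix.transpose_single, Matrix.transpose_single,
        add_comm]
    · have h₁ : ¬ (i = k ∧ j = l) := by
        rintro ⟨rfl, rfl⟩
        exact hij.elim hkl hG
      have h₂ : ¬ (j = k ∧ i = l) := by
        rintro ⟨rfl, rfl⟩
        exact hij.elim (fun e => hkl e.symm) fun e => hG e.symm
      simp [h₁, h₂]
  have := h _ hB
  rw [Matrix.mul_add, Matrix.trace_add, Matrix.trace_mul_single, Matrix.trace_mul_single,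
    hX.apply] at this
  simpa using this

theorem trace_mul_scl_eq_zero {n : ℕ} {G : SimpleGraph (Fin n)}
    {X B : Matrix (Fin n) (Fin n) ℝ} (hX : ∀ i j, i = j ∨ G.Adj i j → X i j = 0)
    (hB : sclMem G B) : (X * B).trace = 0 := by
  simp only [Matrix.trace, Matrix.diag_apply, Matrix.mul_apply]
  refine Finset.sum_eq_zero fun i _ => Finset.sum_eq_zero fun j _ => ?_
  by_cases hij : i = j ∨ G.Adj i j
  · rw [hX i j hij, zero_mul]
  · push Not at hij
    rw [hB.2 j i hij.1.symm fun e => hij.2 e.symm, mul_zero]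

/-- Proposition 1(a): `A ∈ S(G)` has the SSP iff
`S^cl(G) + {KᵀA + AK : K skew-symmetric} = Sym_n(ℝ)`. -/
theorem ssp_iff_sum_eq_sym (n : ℕ) (G : SimpleGraph (Fin n))
    (A : Matrix (Fin n) (Fin n) ℝ) (hA : sMem G A) :
    HasSSP A ↔
      ∀ M : Matrix (Fin n) (Fin n) ℝ, M.IsSymm →
        ∃ B K : Matrix (Fin n) (Fin n) ℝ,
          sclMem G B ∧ Kᵀ = -K ∧ M = B + Kᵀ * A + A * K := by
  constructor
  · intro hSSP M hM
    by_contra hMW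
    change M ∉ sclAddTangent G A at hMW
    obtain ⟨Y, hYW, hYM⟩ := exists_trace_mul_ne_zero_of_notMem hMW
    obtain ⟨X, hXdef⟩ : ∃ X, X = Y + Yᵀ := ⟨_, rfl⟩
    have hX : X.IsSymm := by
      rw [hXdef, Matrix.IsSymm, Matrix.transpose_add, Matrix.transpose_transpose, add_comm]
    have hXW : ∀ N ∈ sclAddTangent G A, (X * N).trace = 0 := fun N hN => by
      rw [hXdef, trace_add_transpose_mul (isSymm_of_mem_sclAddTangent hA.1 hN), hYW N hN,
        mul_zero]
    have hX0 : ∀ {i j}, i = j ∨ G.Adj i j → X i j = 0 := fun hij =>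
      apply_eq_zero_of_trace_mul_scl hX (fun B hB => hXW B ⟨B, 0, hB, by simp, by simp⟩) hij
    have hskew : (X * A - A * X)ᵀ = -(X * A - A * X) := by
      rw [Matrix.transpose_sub, Matrix.transpose_mul, Matrix.transpose_mul, hX.eq, hA.1.eq,
        neg_sub]
    have hcomm : X * A - A * X = 0 := by
      apply eq_zero_of_trace_transpose_mul_self
      rw [hskew, Matrix.neg_mul, Matrix.trace_neg, ← trace_mul_tangent hskew, neg_eq_zero]
      exact hXW _ ⟨0, _, ⟨Matrix.isSymm_zero, fun _ _ _ _ => rfl⟩, hskew, by rw [zero_add]⟩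
    have hXz : X = 0 := by
      refine hSSP X hX (fun i j => ?_) (fun i => hX0 (Or.inl rfl)) (sub_eq_zero.mp hcomm).symm
      by_cases hij : i = j ∨ G.Adj i j
      · rw [hX0 hij, mul_zero]
      · push Not at hij
        rw [not_not.mp (mt (hA.2 i j hij.1).mp hij.2), zero_mul]
    refine mul_ne_zero two_ne_zero hYM ?_
    rw [← trace_add_transpose_mul hM, ← hXdef, hXz, Matrix.zero_mul, Matrix.trace_zero]
  · intro h X hX hAX hXd hcomm
    obtain ⟨B, K, hB, hK, hXeq⟩ := h X hX
    have hX0 : ∀ i j, i = j ∨ G.Adj i j → X i j = 0 := by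
      rintro i j (rfl | hij)
      · exact hXd i
      · exact (mul_eq_zero.mp (hAX i j)).resolve_left ((hA.2 i j hij.ne).mpr hij)
    apply eq_zero_of_trace_transpose_mul_self
    rw [hX.eq]
    calc (X * X).trace = (X * (B + (Kᵀ * A + A * K))).trace := by rw [← add_assoc, ← hXeq]
      _ = 0 := by
        rw [Matrix.mul_add, Matrix.trace_add, trace_mul_scl_eq_zero hX0 hB,
          trace_mul_tangent hK, hcomm, sub_self, Matrix.zero_mul, Matrix.trace_zero, add_zero]
end

section
/- Let U and W be finite-dimensional real normed vector spaces, let F be a C^∞ (smooth) function from an open subset of U to W with F(u₀) = w₀, and suppose the Fréchet derivative of F at u₀ is surjective as a linear map from U to W. Then there exist an open subset W' ⊆ W containing w₀ and a C^∞ function T : W' → U such that T(w₀) = u₀ and F(T(w)) = w for all w ∈ W'. -/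
open scoped ContDiff in
/-- The local inverse of a smooth map with invertible derivative at a point is smooth on an
open neighbourhood of the image point. -/
theorem exists_contDiffOn_local_inverse
    {E G : Type*} [NormedAddCommGroup E] [NormedSpace ℝ E] [CompleteSpace E]
    [NormedAddCommGroup G] [NormedSpace ℝ G]
    {t : Set E} (ht : IsOpen t) {g : E → G} (hg : ContDiffOn ℝ ∞ g t) {a : E} (ha : a ∈ t)
    {g' : E ≃L[ℝ] G} (hg' : HasFDerivAt g (g' : E →L[ℝ] G) a) :
    ∃ V : Set G, IsOpen V ∧ g a ∈ V ∧
      ∃ S : G → E, ContDiffOn ℝ ∞ S V ∧ S (g a) = a ∧ ∀ y ∈ V, g (S y) = y := by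
  have hga : ContDiffAt ℝ ∞ g a := hg.contDiffAt (ht.mem_nhds ha)
  let e := hga.toOpenPartialHomeomorph g hg' (by simp)
  have ha_source : a ∈ e.source := hga.mem_toOpenPartialHomeomorph_source hg' (by simp)
  have hsymm : e.symm (g a) = a := e.left_inv ha_source
  have hequiv : ∀ᶠ x in nhds a, fderiv ℝ g x ∈ Set.range ((↑) : (E ≃L[ℝ] G) → E →L[ℝ] G) := by
    have hcont : ContinuousAt (fderiv ℝ g) a :=
      (hg.continuousOn_fderiv_of_isOpen ht (by simp)).continuousAt (ht.mem_nhds ha)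
    exact hcont.eventually_mem (hg'.fderiv ▸ g'.nhds)
  obtain ⟨v, hv, hvo, hav⟩ := eventually_nhds_iff.1 (hequiv.and (ht.mem_nhds ha))
  refine ⟨e.target ∩ e.symm ⁻¹' v, e.symm.isOpen_inter_preimage hvo,
    ⟨e.map_source ha_source, by rwa [Set.mem_preimage, hsymm]⟩, e.symm, ?_, hsymm,
    fun y hy => e.right_inv hy.1⟩
  rintro y ⟨hy, hyv⟩
  obtain ⟨⟨L, hL⟩, hyt⟩ := hv _ hyv
  have hgy : ContDiffAt ℝ ∞ g (e.symm y) := hg.contDiffAt (ht.mem_nhds hyt)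
  have hderiv : HasFDerivAt g (L : E →L[ℝ] G) (e.symm y) :=
    hL ▸ (hgy.differentiableAt (by simp)).hasFDerivAt
  exact (e.contDiffAt_symm hy hderiv hgy).contDiffWithinAt


/-- Inverse function theorem for a smooth map with surjective derivative:
there is a smooth local right inverse. -/
theorem inverse_function_theorem_surjective
    {U W : Type*} [NormedAddCommGroup U] [NormedSpace ℝ U] [FiniteDimensional ℝ U]
    [NormedAddCommGroup W] [NormedSpace ℝ W] [FiniteDimensional ℝ W]
    (s : Set U) (hs : IsOpen s) (F : U → W) (hF : ContDiffOn ℝ (⊤ : ℕ∞) F s)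
    (u₀ : U) (hu₀ : u₀ ∈ s) (w₀ : W) (hFu₀ : F u₀ = w₀)
    (F' : U →L[ℝ] W) (hF' : HasFDerivAt F F' u₀) (hsurj : Function.Surjective F') :
    ∃ W' : Set W, IsOpen W' ∧ w₀ ∈ W' ∧
      ∃ T : W → U, ContDiffOn ℝ (⊤ : ℕ∞) T W' ∧ T w₀ = u₀ ∧ ∀ w ∈ W', F (T w) = w := by
  obtain ⟨R, hR⟩ := F'.exists_rightInverse_of_surjective (LinearMap.range_eq_top.2 hsurj)
  let A : W → U := fun w => u₀ + R w
  have hA0 : A 0 = u₀ := by simp [A]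
  have hA : ContDiff ℝ (⊤ : ℕ∞) A := contDiff_const.add R.contDiff
  have hderiv : HasFDerivAt (F ∘ A) (ContinuousLinearEquiv.refl ℝ W : W →L[ℝ] W) 0 := by
    have hA' : HasFDerivAt A R 0 := R.hasFDerivAt.const_add u₀
    have hcomp := (hA0.symm ▸ hF' : HasFDerivAt F F' (A 0)).comp 0 hA'
    rwa [hR] at hcomp
  obtain ⟨V, hVo, hV, S, hS, hS0, hright⟩ := exists_contDiffOn_local_inverse
    (hs.preimage hA.continuous) (hF.comp hA.contDiffOn (Set.mapsTo_preimage A s))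
    (by rwa [Set.mem_preimage, hA0]) hderiv
  have hbase : (F ∘ A) 0 = w₀ := by rw [Function.comp_apply, hA0, hFu₀]
  rw [hbase] at hV hS0
  exact ⟨V, hVo, hV, A ∘ S, hA.comp_contDiffOn hS, by rw [Function.comp_apply, hS0, hA0], hright⟩
end

section
/- Let G be a simple graph on n vertices and let A ∈ S(G) have the strong spectral property (SSP). Then there is ε > 0 such that for every n×n real symmetric matrix M with ‖M − A‖ < ε, there exists a matrix A' ∈ S(G) such that A' has the SSP and spec(A') = spec(M). -/
open Matrix Polynomial

/-- The Frobenius norm of a real matrix. -/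
noncomputable def frobNorm {n : ℕ} (A : Matrix (Fin n) (Fin n) ℝ) : ℝ :=
  Real.sqrt (∑ i, ∑ j, (A i j) ^ 2)

open scoped Matrix.Norms.Frobenius Topology

section BifurcationSSP

variable {n : ℕ}

/-- Symmetrization followed by restriction to the diagonal and the edges of `G`. -/
noncomputable def graphProj (G : SimpleGraph (Fin n)) :
    Matrix (Fin n) (Fin n) ℝ →ₗ[ℝ] Matrix (Fin n) (Fin n) ℝ := by
  classical
  exact
  { toFun := fun B => Matrix.of fun i j => if i = j ∨ G.Adj i j then (B i j + B j i) / 2 else 0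
    map_add' := by
      intro B C
      ext i j
      simp only [Matrix.of_apply, Matrix.add_apply]
      split_ifs <;> ring
    map_smul' := by
      intro c B
      ext i j
      simp only [Matrix.of_apply, Matrix.smul_apply, smul_eq_mul, RingHom.id_apply]
      split_ifs <;> ring }

lemma graphProj_apply_of (G : SimpleGraph (Fin n)) (B : Matrix (Fin n) (Fin n) ℝ) {i j : Fin n}
    (h : i = j ∨ G.Adj i j) : graphProj G B i j = (B i j + B j i) / 2 := by
  simp [graphProj, h]

lemma graphProj_apply_of_not (G : SimpleGraph (Fin n)) (B : Matrix (Fin n) (Fin n) ℝ) {i j : Fin n}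
    (h : ¬ (i = j ∨ G.Adj i j)) : graphProj G B i j = 0 := by
  simp [graphProj, h]

lemma graphProj_isSymm (G : SimpleGraph (Fin n)) (B : Matrix (Fin n) (Fin n) ℝ) :
    (graphProj G B).IsSymm := by
  ext i j
  rw [Matrix.transpose_apply]
  by_cases h : i = j ∨ G.Adj i j
  · rw [graphProj_apply_of G B h, graphProj_apply_of G B (h.imp Eq.symm SimpleGraph.Adj.symm)]
    ring
  · rw [graphProj_apply_of_not G B h,
      graphProj_apply_of_not G B fun h' => h (h'.imp Eq.symm SimpleGraph.Adj.symm)]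

lemma graphProj_of_sMem {G : SimpleGraph (Fin n)} {A : Matrix (Fin n) (Fin n) ℝ}
    (hA : sMem G A) : graphProj G A = A := by
  ext i j
  by_cases h : i = j ∨ G.Adj i j
  · rw [graphProj_apply_of G A h, hA.1.apply i j]
    ring
  · rw [graphProj_apply_of_not G A h]
    push Not at h
    by_contra h0
    exact h.2 ((hA.2 i j h.1).1 (Ne.symm h0))

lemma sMem_graphProj {G : SimpleGraph (Fin n)} {B : Matrix (Fin n) (Fin n) ℝ}
    (h : ∀ i j, G.Adj i j → graphProj G B i j ≠ 0) : sMem G (graphProj G B) := by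
  refine ⟨graphProj_isSymm G B, fun i j hij => ⟨fun h0 => ?_, h i j⟩⟩
  by_contra hn
  exact h0 (graphProj_apply_of_not G B (by tauto))

/-- The skew-symmetric matrix `Z - Zᵀ`. -/
def skewPart : Matrix (Fin n) (Fin n) ℝ →ₗ[ℝ] Matrix (Fin n) (Fin n) ℝ :=
  LinearMap.id - (Matrix.transposeLinearEquiv (Fin n) (Fin n) ℝ ℝ).toLinearMap

@[simp] lemma skewPart_apply (Z : Matrix (Fin n) (Fin n) ℝ) : skewPart Z = Z - Zᵀ := rfl

lemma eq_of_isSymm_of_add_skewPart {S M Z : Matrix (Fin n) (Fin n) ℝ} (hS : S.IsSymm)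
    (hM : M.IsSymm) (h : S + skewPart Z = M) : S = M := by
  have h' := congrArg Matrix.transpose h
  simp only [skewPart_apply, Matrix.transpose_add, Matrix.transpose_sub,
    Matrix.transpose_transpose, hS.eq, hM.eq] at h'
  rw [skewPart_apply] at h
  ext i j
  have h1 := congrFun (congrFun h i) j
  have h2 := congrFun (congrFun h' i) j
  simp only [Matrix.add_apply, Matrix.sub_apply] at h1 h2
  linarith

/-- A linear functional on matrices is given by the trace pairing. -/
lemma exists_trace_mul_eq (φ : Matrix (Fin n) (Fin n) ℝ →ₗ[ℝ] ℝ) :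
    ∃ X : Matrix (Fin n) (Fin n) ℝ, ∀ Y, φ Y = (X * Y).trace := by
  refine ⟨Matrix.of fun j i => φ (Matrix.single i j 1), fun Y => ?_⟩
  conv_lhs => rw [Matrix.matrix_eq_sum_single Y]
  simp only [map_sum, Matrix.trace, Matrix.diag_apply, Matrix.mul_apply, Matrix.of_apply]
  rw [Finset.sum_comm]
  refine Finset.sum_congr rfl fun i _ => Finset.sum_congr rfl fun j _ => ?_
  rw [show Matrix.single j i (Y j i) = Y j i • Matrix.single j i (1 : ℝ) by
    simp [Matrix.smul_single], map_smul, smul_eq_mul, mul_comm]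

/-- The strong spectral property in dual form: the pattern space and the commutators of `A` with
skew-symmetric matrices span the symmetric matrices. -/
lemma HasSSP.exists_decomposition {G : SimpleGraph (Fin n)} {A : Matrix (Fin n) (Fin n) ℝ}
    (hA : sMem G A) (hssp : HasSSP A) (S : Matrix (Fin n) (Fin n) ℝ) :
    ∃ B K Z, graphProj G B + (A * skewPart K - skewPart K * A) + skewPart Z = S := by
  let L : Matrix (Fin n) (Fin n) ℝ × Matrix (Fin n) (Fin n) ℝ × Matrix (Fin n) (Fin n) ℝ →ₗ[ℝ]
      Matrix (Fin n) (Fin n) ℝ :=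
    (graphProj G).coprod (((LinearMap.mulLeft ℝ A - LinearMap.mulRight ℝ A).comp
      skewPart).coprod skewPart)
  have hL : ∀ B K Z, L (B, K, Z) =
      graphProj G B + (A * skewPart K - skewPart K * A) + skewPart Z := by
    intro B K Z
    simp only [L, LinearMap.coprod_apply, LinearMap.comp_apply, LinearMap.sub_apply,
      LinearMap.mulLeft_apply, LinearMap.mulRight_apply, add_assoc]
  suffices h : LinearMap.range L = ⊤ by
    obtain ⟨⟨B, K, Z⟩, h⟩ := LinearMap.range_eq_top.1 h S
    exact ⟨B, K, Z, (hL B K Z).symm.trans h⟩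
  by_contra hne
  obtain ⟨φ, hφ, hle⟩ := Submodule.exists_le_ker_of_lt_top _ (lt_top_iff_ne_top.2 hne)
  obtain ⟨X, hX⟩ := exists_trace_mul_eq φ
  have h0 : ∀ B K Z, (X * (graphProj G B + (A * skewPart K - skewPart K * A)
      + skewPart Z)).trace = 0 := by
    intro B K Z
    rw [← hX, ← hL]
    exact LinearMap.mem_ker.1 (hle (LinearMap.mem_range_self L _))
  have hsymm : X.IsSymm := by
    ext i j
    have := h0 0 0 (Matrix.single i j 1)
    simp [Matrix.mul_sub, Matrix.trace_mul_single] at this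
    rw [Matrix.transpose_apply]
    linarith
  have hzero : ∀ i j, (i = j ∨ G.Adj i j) → X i j = 0 := by
    intro i j hij
    have hp : graphProj G (Matrix.single i j 1) =
        (1 / 2 : ℝ) • (Matrix.single i j 1 + Matrix.single j i 1) := by
      ext k l
      by_cases hkl : k = l ∨ G.Adj k l
      · rw [graphProj_apply_of G _ hkl]
        simp [Matrix.single_apply, and_comm]
        ring
      · rw [graphProj_apply_of_not G _ hkl]
        have h1 : ¬ (i = k ∧ j = l) := by
          rintro ⟨rfl, rfl⟩; exact hkl hij
        have h2 : ¬ (j = k ∧ i = l) := by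
          rintro ⟨rfl, rfl⟩; exact hkl (hij.imp Eq.symm SimpleGraph.Adj.symm)
        simp [h1, h2]
    have := h0 (Matrix.single i j 1) 0 0
    rw [hp] at this
    simp [Matrix.mul_add, Matrix.trace_mul_single, -one_div] at this
    have h3 := hsymm.apply i j
    linarith
  have hcomm : A * X = X * A := by
    set W := X * A - A * X with hW
    have hWt : Wᵀ = -W := by
      rw [hW, Matrix.transpose_sub, Matrix.transpose_mul, Matrix.transpose_mul, hsymm.eq, hA.1.eq]
      abel
    have h1 := h0 0 W 0
    have h2 : (Wᵀ * W).trace = 0 := by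
      have h3 : (X * (A * W - W * A)).trace = (W * W).trace := by
        rw [hW, Matrix.mul_sub X, Matrix.trace_sub, ← Matrix.mul_assoc X _ A,
          Matrix.trace_mul_comm _ A, ← Matrix.mul_assoc, ← Matrix.mul_assoc, ← Matrix.trace_sub,
          ← Matrix.sub_mul]
      have h4 : skewPart W = (2 : ℝ) • W := by
        rw [skewPart_apply, hWt, two_smul, sub_neg_eq_add]
      rw [h4] at h1
      simp only [map_zero, zero_add, add_zero, Matrix.mul_smul, Matrix.smul_mul,
        ← smul_sub, Matrix.trace_smul, h3] at h1
      rw [hWt, Matrix.neg_mul, Matrix.trace_neg]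
      simpa using h1
    have h5 : W = 0 := by
      rw [← Matrix.trace_conjTranspose_mul_self_eq_zero_iff]
      rwa [Matrix.conjTranspose_eq_transpose_of_trivial]
    exact (sub_eq_zero.1 h5).symm
  have hX0 : X = 0 := by
    refine hssp X hsymm (fun i j => ?_) (fun i => hzero i i (Or.inl rfl)) hcomm
    by_cases hij : i = j ∨ G.Adj i j
    · rw [hzero i j hij, mul_zero]
    · push Not at hij
      by_cases hAij : A i j = 0
      · rw [hAij, zero_mul]
      · exact absurd ((hA.2 i j hij.1).1 hAij) hij.2
  apply hφ
  ext1 Y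
  simp [hX, hX0]

/-- Among matrices in `S(G)`, the strong spectral property is an open condition. -/
lemma HasSSP.eventually {G : SimpleGraph (Fin n)} {A : Matrix (Fin n) (Fin n) ℝ}
    (hA : sMem G A) (hssp : HasSSP A) :
    ∀ᶠ B in 𝓝 A, sMem G B → HasSSP B := by
  let T₁ : Matrix (Fin n) (Fin n) ℝ →L[ℝ] Matrix (Fin n) (Fin n) ℝ × Matrix (Fin n) (Fin n) ℝ :=
    LinearMap.toContinuousLinearMap ((graphProj G).prod skewPart)
  let T : Matrix (Fin n) (Fin n) ℝ → (Matrix (Fin n) (Fin n) ℝ →L[ℝ]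
      (Matrix (Fin n) (Fin n) ℝ × Matrix (Fin n) (Fin n) ℝ) × Matrix (Fin n) (Fin n) ℝ) := fun B =>
    (ContinuousLinearMap.inl ℝ _ _).comp T₁ + (ContinuousLinearMap.inr ℝ _ _).comp
      (ContinuousLinearMap.mul ℝ _ B - (ContinuousLinearMap.mul ℝ _).flip B)
  have hT : ∀ B X, T B X = ((graphProj G X, skewPart X), B * X - X * B) := by
    intro B X
    change ((graphProj G X, skewPart X), (0 : Matrix (Fin n) (Fin n) ℝ)) +
      ((0, 0), B * X - X * B) = _
    simp
  have hcont : Continuous T := by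
    refine continuous_const.add (continuous_const.clm_comp ?_)
    exact (ContinuousLinearMap.continuous _).sub (ContinuousLinearMap.continuous _)
  have hker : ∀ B X, T B X = 0 ↔
      (X.IsSymm ∧ (∀ i j, (i = j ∨ G.Adj i j) → X i j = 0) ∧ B * X = X * B) := by
    intro B X
    rw [hT, Prod.mk_eq_zero, Prod.mk_eq_zero, sub_eq_zero, skewPart_apply, sub_eq_zero]
    constructor
    · rintro ⟨⟨h1, h2⟩, h3⟩
      refine ⟨h2.symm, fun i j hij => ?_, h3⟩
      have h4 := congrFun (congrFun h1 i) j
      rw [graphProj_apply_of G X hij, (show X.IsSymm from h2.symm).apply i j] at h4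
      simpa using h4
    · rintro ⟨h1, h2, h3⟩
      refine ⟨⟨?_, h1.eq.symm⟩, h3⟩
      ext i j
      by_cases hij : i = j ∨ G.Adj i j
      · rw [graphProj_apply_of G X hij, h1.apply i j, h2 i j hij]
        simp
      · rw [graphProj_apply_of_not G X hij]
        rfl
  have hinj : Function.Injective (T A) := by
    rw [injective_iff_map_eq_zero]
    intro X hX
    obtain ⟨h1, h2, h3⟩ := (hker A X).1 hX
    refine hssp X h1 (fun i j => ?_) (fun i => h2 i i (Or.inl rfl)) h3
    by_cases hij : i = j ∨ G.Adj i j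
    · rw [h2 i j hij, mul_zero]
    · push Not at hij
      by_cases hAij : A i j = 0
      · rw [hAij, zero_mul]
      · exact absurd ((hA.2 i j hij.1).1 hAij) hij.2
  have hev : ∀ᶠ B in 𝓝 A, Function.Injective (T B) :=
    hcont.continuousAt.eventually (ContinuousLinearMap.isOpen_injective.mem_nhds hinj)
  filter_upwards [hev] with B hB hBG X h1 h2 h3 h4
  refine (injective_iff_map_eq_zero (T B)).1 hB X ((hker B X).2 ⟨h1, ?_, h4⟩)
  rintro i j (rfl | hij)
  · exact h3 i
  · exact (mul_eq_zero.1 (h2 i j)).resolve_left ((hBG.2 i j hij.ne).2 hij)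

lemma sMem.eventually_graphProj {G : SimpleGraph (Fin n)} {A : Matrix (Fin n) (Fin n) ℝ}
    (hA : sMem G A) (hssp : HasSSP A) :
    ∀ᶠ B in 𝓝 A, sMem G (graphProj G B) ∧ HasSSP (graphProj G B) := by
  have hc : Continuous (graphProj G) := (graphProj G).continuous_of_finiteDimensional
  have h1 : ∀ᶠ B in 𝓝 A, sMem G (graphProj G B) → HasSSP (graphProj G B) := by
    have ht : Filter.Tendsto (graphProj G) (𝓝 A) (𝓝 A) := by
      simpa only [graphProj_of_sMem hA] using hc.tendsto A
    exact ht.eventually (hssp.eventually hA)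
  have h2 : ∀ᶠ B in 𝓝 A, ∀ i j, G.Adj i j → graphProj G B i j ≠ 0 := by
    refine Filter.eventually_all.2 fun i => Filter.eventually_all.2 fun j => ?_
    by_cases hij : G.Adj i j
    · have h3 : Continuous fun B => graphProj G B i j := hc.matrix_elem i j
      filter_upwards [h3.continuousAt.eventually_ne (y := 0) (x := A)
        (by rw [graphProj_of_sMem hA]; exact (hA.2 i j hij.ne).2 hij)] with B hB _ using hB
    · exact Filter.Eventually.of_forall fun B h => absurd h hij
  filter_upwards [h1, h2] with B h1 h2
  exact ⟨sMem_graphProj h2, h1 (sMem_graphProj h2)⟩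

/-- Symmetric matrices near `A` are orthogonally similar to matrices in the pattern space
near `A`. -/
lemma HasSSP.eventually_exists_conj {G : SimpleGraph (Fin n)} {A : Matrix (Fin n) (Fin n) ℝ}
    (hA : sMem G A) (hssp : HasSSP A) {p : Matrix (Fin n) (Fin n) ℝ → Prop}
    (hp : ∀ᶠ B in 𝓝 A, p B) :
    ∀ᶠ M in 𝓝 A, M.IsSymm → ∃ B Q : Matrix (Fin n) (Fin n) ℝ,
      p B ∧ Qᵀ * Q = 1 ∧ Qᵀ * graphProj G B * Q = M := by
  let P : Matrix (Fin n) (Fin n) ℝ →L[ℝ] Matrix (Fin n) (Fin n) ℝ :=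
    LinearMap.toContinuousLinearMap (graphProj G)
  let K : Matrix (Fin n) (Fin n) ℝ →L[ℝ] Matrix (Fin n) (Fin n) ℝ :=
    LinearMap.toContinuousLinearMap skewPart
  let t : Matrix (Fin n) (Fin n) ℝ →L[ℝ] Matrix (Fin n) (Fin n) ℝ :=
    LinearMap.toContinuousLinearMap (Matrix.transposeLinearEquiv (Fin n) (Fin n) ℝ ℝ).toLinearMap
  let E := (Matrix (Fin n) (Fin n) ℝ × Matrix (Fin n) (Fin n) ℝ) ×
    (Matrix (Fin n) (Fin n) ℝ × Matrix (Fin n) (Fin n) ℝ)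
  let pB : E →L[ℝ] Matrix (Fin n) (Fin n) ℝ :=
    (ContinuousLinearMap.fst ℝ _ _).comp (ContinuousLinearMap.fst ℝ _ _)
  let pQ : E →L[ℝ] Matrix (Fin n) (Fin n) ℝ :=
    (ContinuousLinearMap.snd ℝ _ _).comp (ContinuousLinearMap.fst ℝ _ _)
  let pY : E →L[ℝ] Matrix (Fin n) (Fin n) ℝ :=
    (ContinuousLinearMap.fst ℝ _ _).comp (ContinuousLinearMap.snd ℝ _ _)
  let pZ : E →L[ℝ] Matrix (Fin n) (Fin n) ℝ :=
    (ContinuousLinearMap.snd ℝ _ _).comp (ContinuousLinearMap.snd ℝ _ _)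
  let F : E → Matrix (Fin n) (Fin n) ℝ × Matrix (Fin n) (Fin n) ℝ := fun e =>
    ((t.comp pQ) e * (P.comp pB) e * pQ e + (K.comp pY) e, (t.comp pQ) e * pQ e + (K.comp pZ) e)
  let e₀ : E := ((A, 1), (0, 0))
  have hF := (((((t.comp pQ).hasStrictFDerivAt (x := e₀)).mul'
    ((P.comp pB).hasStrictFDerivAt (x := e₀))).mul' (pQ.hasStrictFDerivAt (x := e₀))).add
    ((K.comp pY).hasStrictFDerivAt (x := e₀))).prodMk
    ((((t.comp pQ).hasStrictFDerivAt (x := e₀)).mul' (pQ.hasStrictFDerivAt (x := e₀))).add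
    ((K.comp pZ).hasStrictFDerivAt (x := e₀)))
  have hPA : graphProj G A = A := graphProj_of_sMem hA
  have hF₀ : F e₀ = (A, 1) := by
    change (1ᵀ * graphProj G A * 1 + skewPart 0, 1ᵀ * 1 + skewPart 0) = (A, 1)
    simp [hPA]
  have hmap := hF.map_nhds_eq_of_surj (by
    rw [LinearMap.range_eq_top]
    rintro ⟨S, U⟩
    obtain ⟨B, C, Z, h⟩ := hssp.exists_decomposition hA
      (S - (1 / 4 : ℝ) • ((U + Uᵀ) * A + A * (U + Uᵀ)))
    set Q := (1 / 4 : ℝ) • (U + Uᵀ) + skewPart C with hQ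
    have hQt : Qᵀ = (1 / 4 : ℝ) • (U + Uᵀ) - skewPart C := by
      simp only [hQ, skewPart_apply, Matrix.transpose_add, Matrix.transpose_smul,
        Matrix.transpose_sub, Matrix.transpose_transpose]
      module
    refine ⟨((B, Q), (Z, (1 / 2 : ℝ) • U)), ?_⟩
    change (1ᵀ * graphProj G A * Q + (1ᵀ * graphProj G B + Qᵀ * graphProj G A) * 1 + skewPart Z,
      1ᵀ * Q + Qᵀ * 1 + skewPart ((1 / 2 : ℝ) • U)) = (S, U)
    rw [hPA, hQt, hQ, Matrix.transpose_one]
    refine Prod.ext ?_ ?_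
    · rw [eq_sub_iff_add_eq] at h
      simp only [← h, one_mul, mul_one, add_mul, mul_add, sub_mul, smul_mul_assoc,
        mul_smul_comm]
      module
    · simp only [one_mul, mul_one, skewPart_apply, Matrix.transpose_smul]
      module)
  have hp' : ∀ᶠ e in 𝓝 e₀, p (pB e) := pB.continuous.continuousAt.eventually hp
  have himg := Filter.image_mem_map (m := F) hp'
  have hmap' : Filter.map F (𝓝 e₀) = 𝓝 (A, 1) := by
    rw [← hF₀]; exact hmap
  rw [hmap'] at himg
  have hc : ContinuousAt (fun M : Matrix (Fin n) (Fin n) ℝ =>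
    (M, (1 : Matrix (Fin n) (Fin n) ℝ))) A := by fun_prop
  filter_upwards [hc himg] with M hM hMs
  obtain ⟨e, he, heM⟩ := hM
  obtain ⟨h1, h2⟩ := Prod.ext_iff.1 heM
  refine ⟨pB e, pQ e, he, ?_, ?_⟩
  · exact eq_of_isSymm_of_add_skewPart (Matrix.isSymm_transpose_mul_self _) Matrix.isSymm_one h2
  · refine eq_of_isSymm_of_add_skewPart ?_ hMs h1
    rw [Matrix.IsSymm, Matrix.transpose_mul, Matrix.transpose_mul, Matrix.transpose_transpose,
      (graphProj_isSymm G _).eq, Matrix.mul_assoc]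

lemma charpoly_transpose_mul_mul {B Q : Matrix (Fin n) (Fin n) ℝ} (hQ : Qᵀ * Q = 1) :
    (Qᵀ * B * Q).charpoly = B.charpoly := by
  rw [Matrix.charpoly_mul_comm, ← Matrix.mul_assoc, mul_eq_one_comm.1 hQ, Matrix.one_mul]

lemma frobNorm_eq_norm (A : Matrix (Fin n) (Fin n) ℝ) : frobNorm A = ‖A‖ := by
  rw [frobNorm, Matrix.frobenius_norm_def, Real.sqrt_eq_rpow]
  simp

end BifurcationSSP

/-- Bifurcation lemma for the SSP: nearby spectra of symmetric matrices are realizable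
in `S(G)` with the SSP.  (Two real symmetric matrices have the same spectrum, with
multiplicity, iff they have the same characteristic polynomial.) -/
theorem bifurcation_ssp (n : ℕ) (G : SimpleGraph (Fin n))
    (A : Matrix (Fin n) (Fin n) ℝ) (hA : sMem G A) (hssp : HasSSP A) :
    ∃ ε > 0, ∀ M : Matrix (Fin n) (Fin n) ℝ, M.IsSymm → frobNorm (M - A) < ε →
      ∃ A' : Matrix (Fin n) (Fin n) ℝ,
        sMem G A' ∧ HasSSP A' ∧ A'.charpoly = M.charpoly := by
  obtain ⟨ε, hε, h⟩ := Metric.eventually_nhds_iff.1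
    (hssp.eventually_exists_conj hA (hA.eventually_graphProj hssp))
  refine ⟨ε, hε, fun M hM hMA => ?_⟩
  rw [frobNorm_eq_norm, ← dist_eq_norm] at hMA
  obtain ⟨B, Q, ⟨hB, hBS⟩, hQ, rfl⟩ := h hMA hM
  exact ⟨graphProj G B, hB, hBS, (charpoly_transpose_mul_mul hQ).symm⟩
end

section
/- Let G be a simple graph on n vertices and let A ∈ S(G) have the strong multiplicity property (SMP). Then there is ε > 0 such that for every n×n real symmetric matrix M with ‖M − A‖ < ε, there exists a matrix A' ∈ S(G) such that A' has the SMP and m(A') = m(M) (A' and M have the same ordered multiplicity list). -/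
open Matrix Polynomial

/-- The number of distinct (real) eigenvalues of `A`. -/
noncomputable def qDist {n : ℕ} (A : Matrix (Fin n) (Fin n) ℝ) : ℕ :=
  A.charpoly.roots.toFinset.card

/-- The strong multiplicity property. -/
def HasSMP {n : ℕ} (A : Matrix (Fin n) (Fin n) ℝ) : Prop :=
  ∀ X : Matrix (Fin n) (Fin n) ℝ, X.IsSymm →
    (∀ i j, A i j * X i j = 0) → (∀ i, X i i = 0) → A * X = X * A →
    (∀ k < qDist A, Matrix.trace (A ^ k * X) = 0) → X = 0

/-- The ordered multiplicity list of `A`: the multiplicities of the distinct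
eigenvalues of `A`, listed in increasing order of the eigenvalues. -/
noncomputable def omlist {n : ℕ} (A : Matrix (Fin n) (Fin n) ℝ) : List ℕ :=
  (A.charpoly.roots.toFinset.sort (· ≤ ·)).map fun x => A.charpoly.roots.count x

theorem Matrix.IsSymm.exists_diagonalization {n : ℕ} {A : Matrix (Fin n) (Fin n) ℝ}
    (hA : A.IsSymm) :
    ∃ (U V : Matrix (Fin n) (Fin n) ℝ) (d : Fin n → ℝ),
      V * U = 1 ∧ A = U * diagonal d * V := by
  have hH : A.IsHermitian := by
    rw [Matrix.IsHermitian, conjTranspose_eq_transpose_of_trivial]; exact hA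
  refine ⟨hH.eigenvectorUnitary, star (hH.eigenvectorUnitary : Matrix (Fin n) (Fin n) ℝ),
    hH.eigenvalues, ?_, ?_⟩
  · exact Unitary.coe_star_mul_self _
  · exact hH.spectral_theorem

theorem Matrix.aeval_conj_diagonal {n : ℕ} {U V : Matrix (Fin n) (Fin n) ℝ} (hVU : V * U = 1)
    (d : Fin n → ℝ) (p : ℝ[X]) :
    aeval (U * diagonal d * V) p = U * diagonal (fun i => p.eval (d i)) * V := by
  have hUV : U * V = 1 := mul_eq_one_comm.mp hVU
  induction p using Polynomial.induction_on' with
  | add p q hp hq =>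
    simp only [map_add, hp, hq, eval_add, ← diagonal_add, mul_add, add_mul]
  | monomial k a =>
    have hpow : (U * diagonal d * V) ^ k = U * diagonal (fun i => d i ^ k) * V := by
      induction k with
      | zero => simp [hUV]
      | succ k ih =>
        rw [pow_succ, ih]
        calc _ = U * diagonal (fun i => d i ^ k) * (V * U) * diagonal d * V := by
              simp only [Matrix.mul_assoc]
          _ = _ := by
              rw [hVU, Matrix.mul_one, Matrix.mul_assoc U, diagonal_mul_diagonal]
              simp only [pow_succ]
    have hsmul : diagonal (fun i => a * d i ^ k) = a • diagonal (fun i => d i ^ k) := by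
      rw [← diagonal_smul]; rfl
    rw [aeval_monomial, hpow]
    simp only [eval_monomial, hsmul, Matrix.mul_smul, Matrix.smul_mul,
      Algebra.algebraMap_eq_smul_one, one_mul]

theorem Matrix.roots_charpoly_conj_diagonal {n : ℕ} {U V : Matrix (Fin n) (Fin n) ℝ}
    (hVU : V * U = 1) (d : Fin n → ℝ) :
    (U * diagonal d * V).charpoly.roots = Finset.univ.val.map d := by
  rw [Matrix.charpoly_mul_comm, ← Matrix.mul_assoc, hVU, Matrix.one_mul, charpoly_diagonal,
    Polynomial.roots_prod _ _ (Finset.prod_ne_zero_iff.mpr fun i _ => X_sub_C_ne_zero _)]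
  simp

/-- The eigenvalues of `p(A)`, with multiplicity, are the values of `p` at the eigenvalues
of `A`. -/
theorem Matrix.IsSymm.roots_charpoly_aeval {n : ℕ} {A : Matrix (Fin n) (Fin n) ℝ}
    (hA : A.IsSymm) (p : ℝ[X]) :
    (aeval A p).charpoly.roots = A.charpoly.roots.map p.eval := by
  obtain ⟨U, V, d, hVU, rfl⟩ := hA.exists_diagonalization
  rw [aeval_conj_diagonal hVU, roots_charpoly_conj_diagonal hVU, roots_charpoly_conj_diagonal hVU,
    Multiset.map_map]
  rfl

/-- Every power of a symmetric matrix with `q` distinct eigenvalues is a combination of the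
powers with exponent less than `q`. -/
theorem trace_pow_mul_eq_zero {n : ℕ} {A X : Matrix (Fin n) (Fin n) ℝ} (hA : A.IsSymm)
    (h : ∀ k < qDist A, trace (A ^ k * X) = 0) (k : ℕ) : trace (A ^ k * X) = 0 := by
  set μ : ℝ[X] := ∏ x ∈ A.charpoly.roots.toFinset, (Polynomial.X - C x) with hμ
  have hmonic : μ.Monic := monic_prod_of_monic _ _ fun x _ => monic_X_sub_C x
  have hdeg : μ.natDegree = qDist A := by
    rw [hμ, natDegree_prod_of_monic _ _ fun x _ => monic_X_sub_C x]
    simp [qDist]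
  have hroot : aeval A μ = 0 := by
    have key : ∀ x ∈ A.charpoly.roots, μ.eval x = 0 := fun x hx => by
      rw [hμ, eval_prod]
      exact Finset.prod_eq_zero (Multiset.mem_toFinset.mpr hx) (by simp)
    clear_value μ
    obtain ⟨U, V, d, hVU, rfl⟩ := hA.exists_diagonalization
    rw [roots_charpoly_conj_diagonal hVU] at key
    rw [aeval_conj_diagonal hVU]
    have : (fun i => μ.eval (d i)) = 0 := funext fun i => key _ (by simp)
    rw [this]; simp
  have hmod : A ^ k = aeval A ((Polynomial.X ^ k : ℝ[X]) %ₘ μ) := by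
    rw [aeval_modByMonic_eq_self_of_root hroot]; simp
  rcases Nat.eq_zero_or_pos (qDist A) with h0 | hpos
  · have h1 : μ = 1 := (Monic.natDegree_eq_zero hmonic).mp (hdeg.trans h0)
    rw [hmod, h1]; simp
  · rw [hmod, aeval_eq_sum_range' (n := qDist A), Finset.sum_mul, trace_sum]
    · refine Finset.sum_eq_zero fun i hi => ?_
      rw [Matrix.smul_mul, trace_smul, h i (Finset.mem_range.mp hi), smul_zero]
    · rw [← hdeg] at hpos ⊢
      exact natDegree_modByMonic_lt _ hmonic fun h1 => by simp [h1] at hpos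

theorem omlist_eq_of_roots_eq_map {n : ℕ} {A B : Matrix (Fin n) (Fin n) ℝ} {f : ℝ → ℝ}
    (hf : StrictMonoOn f {x | x ∈ A.charpoly.roots})
    (h : B.charpoly.roots = A.charpoly.roots.map f) : omlist B = omlist A := by
  unfold omlist
  have hinj : Set.InjOn f (A.charpoly.roots.toFinset : Set ℝ) :=
    hf.injOn.mono fun x hx => by simpa using hx
  have hsort : B.charpoly.roots.toFinset.sort (· ≤ ·) =
      (A.charpoly.roots.toFinset.sort (· ≤ ·)).map f := by
    rw [h, Multiset.toFinset_map, ← Finset.sort_val, ← Finset.sort_val,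
      Finset.image_val_of_injOn hinj]
    refine (Multiset.map_sort _ _ _ _ fun a ha b hb => ?_).symm
    exact (hf.le_iff_le (by simpa using ha) (by simpa using hb)).symm
  rw [hsort, List.map_map, h]
  refine List.map_congr_left fun x hx => ?_
  have hx' : x ∈ A.charpoly.roots := by simpa using hx
  exact Multiset.count_map_eq_count _ _ hf.injOn _ hx'

section Perturbation

open scoped Matrix.Norms.Operator Topology
open NormedSpace (exp)

/-- The entries of `X + Xᵀ` at the off-diagonal nonedges of `G`. -/
noncomputable def nonedgePart {n : ℕ} (G : SimpleGraph (Fin n)) :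
    Matrix (Fin n) (Fin n) ℝ →ₗ[ℝ] Matrix (Fin n) (Fin n) ℝ :=
  open Classical in
  { toFun := fun X => of fun i j => if i = j ∨ G.Adj i j then 0 else X i j + X j i
    map_add' := fun X Y => by
      ext i j
      by_cases h : i = j ∨ G.Adj i j <;> simp [h]; ring
    map_smul' := fun c X => by
      ext i j
      by_cases h : i = j ∨ G.Adj i j <;> simp [h]; ring }

theorem nonedgePart_apply_of_nonedge {n : ℕ} {G : SimpleGraph (Fin n)} {i j : Fin n}
    (hij : i ≠ j) (h : ¬ G.Adj i j) (X : Matrix (Fin n) (Fin n) ℝ) :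
    nonedgePart G X i j = X i j + X j i := by
  simp [nonedgePart, hij, h]

theorem nonedgePart_eq_zero {n : ℕ} {G : SimpleGraph (Fin n)} {X : Matrix (Fin n) (Fin n) ℝ}
    (h : ∀ i j, i ≠ j → ¬ G.Adj i j → X i j + X j i = 0) : nonedgePart G X = 0 := by
  ext i j
  by_cases hij : i = j ∨ G.Adj i j
  · simp [nonedgePart, hij]
  · rw [not_or] at hij
    rw [nonedgePart_apply_of_nonedge hij.1 hij.2, h i j hij.1 hij.2, Matrix.zero_apply]

theorem nonedgePart_transpose {n : ℕ} (G : SimpleGraph (Fin n)) (X : Matrix (Fin n) (Fin n) ℝ) :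
    nonedgePart G Xᵀ = nonedgePart G X := by
  ext i j
  simp [nonedgePart, add_comm]

/-- The tangent map of `(K, c) ↦ e^{-K} (A + ∑ c_k A^k) e^K` at the origin, where `K` is
replaced by its skew-symmetric part `K - Kᵀ`. -/
noncomputable def orbitTangentMap {n : ℕ} (N : ℕ) (A : Matrix (Fin n) (Fin n) ℝ) :
    (Matrix (Fin n) (Fin n) ℝ × (Fin N → ℝ)) →ₗ[ℝ] Matrix (Fin n) (Fin n) ℝ where
  toFun y := A * (y.1 - y.1ᵀ) - (y.1 - y.1ᵀ) * A + ∑ k, y.2 k • A ^ (k : ℕ)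
  map_add' y z := by
    simp only [Prod.fst_add, Prod.snd_add, transpose_add, Pi.add_apply, add_smul,
      Finset.sum_add_distrib]
    noncomm_ring
  map_smul' c y := by
    simp only [Prod.smul_fst, Prod.smul_snd, transpose_smul, Pi.smul_apply, smul_eq_mul,
      mul_smul, ← Finset.smul_sum, RingHom.id_apply, ← smul_sub, Matrix.mul_smul,
      Matrix.smul_mul, smul_add]

/-- A linear functional on matrices is `trace (X * ·)` for some matrix `X`. -/
theorem exists_eq_trace_mul {n : ℕ} (f : Matrix (Fin n) (Fin n) ℝ →ₗ[ℝ] ℝ) (Y) :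
    f Y = trace ((of fun i j => f (single j i 1)) * Y) := by
  conv_lhs => rw [matrix_eq_sum_single Y]
  simp only [map_sum, trace, diag_apply, mul_apply, of_apply]
  rw [Finset.sum_comm]
  refine Finset.sum_congr rfl fun i _ => Finset.sum_congr rfl fun j _ => ?_
  rw [mul_comm, ← smul_eq_mul, ← map_smul, smul_single, smul_eq_mul, mul_one]

/-- The SMP says that orbit directions, polynomials in `A` and the pattern of `G` together span
all symmetric matrices. -/
theorem HasSMP.range_nonedgePart_comp_orbitTangentMap {n : ℕ} {G : SimpleGraph (Fin n)}
    {A : Matrix (Fin n) (Fin n) ℝ} (hA : sMem G A) (h : HasSMP A) :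
    LinearMap.range ((nonedgePart G).rangeRestrict ∘ₗ orbitTangentMap (qDist A) A) = ⊤ := by
  by_contra hne
  obtain ⟨f, hf0, hf⟩ := Submodule.exists_le_ker_of_lt_top _ (lt_top_iff_ne_top.mpr hne)
  set g : Matrix (Fin n) (Fin n) ℝ →ₗ[ℝ] ℝ := f ∘ₗ (nonedgePart G).rangeRestrict with hg
  set X : Matrix (Fin n) (Fin n) ℝ := of fun i j => g (single j i 1) with hX
  have hgX : ∀ Y, g Y = trace (X * Y) := exists_eq_trace_mul g
  have hgt : ∀ y, g (orbitTangentMap (qDist A) A y) = 0 := fun y => hf ⟨y, rfl⟩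
  have hg0 : ∀ Y, nonedgePart G Y = 0 → g Y = 0 := fun Y hY => by
    have : (nonedgePart G).rangeRestrict Y = 0 := Subtype.ext hY
    rw [hg, LinearMap.comp_apply, this, map_zero]
  have hsymm : X.IsSymm := by
    ext i j
    rw [transpose_apply, hX, of_apply, of_apply, ← sub_eq_zero, ← map_sub]
    apply hg0
    rw [map_sub, ← nonedgePart_transpose, transpose_single, sub_self]
  have hmask : ∀ i j, (i = j ∨ G.Adj i j) → X i j = 0 := fun i j hij => by
    rw [hX, of_apply]
    refine hg0 _ (nonedgePart_eq_zero fun a b hab hnab => ?_)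
    have h1 : ¬ (j = a ∧ i = b) := by
      rintro ⟨rfl, rfl⟩
      rcases hij with e | e
      · exact hab e.symm
      · exact hnab e.symm
    have h2 : ¬ (j = b ∧ i = a) := by
      rintro ⟨rfl, rfl⟩
      rcases hij with e | e
      · exact hab e
      · exact hnab e
    simp [h1, h2]
  have hcomm : A * X = X * A := by
    set Z := X * A - A * X with hZ
    have hZt : Zᵀ = -Z := by
      rw [hZ, transpose_sub, transpose_mul, transpose_mul, hsymm.eq, hA.1.eq]; abel
    have hZ0 : ∀ K, trace (K * Z) = 0 := fun K => by
      have h1 := hgt (K, 0)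
      rw [hgX] at h1
      have e1 : trace (X * orbitTangentMap (qDist A) A (K, 0)) = trace ((K - Kᵀ) * Z) := by
        rw [trace_mul_comm (K - Kᵀ), hZ]
        simp only [orbitTangentMap, LinearMap.coe_mk, AddHom.coe_mk, Pi.zero_apply, zero_smul,
          Finset.sum_const_zero, add_zero]
        rw [Matrix.mul_sub, trace_sub, Matrix.sub_mul (X * A), trace_sub, ← Matrix.mul_assoc X A,
          ← Matrix.mul_assoc X, trace_mul_comm (X * (K - Kᵀ)) A, Matrix.mul_assoc A X]
      have e2 : trace (Kᵀ * Z) = - trace (K * Z) := by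
        rw [← trace_transpose, transpose_mul, transpose_transpose, hZt, Matrix.neg_mul, trace_neg,
          trace_mul_comm]
      rw [e1, Matrix.sub_mul, trace_sub, e2] at h1
      linarith
    have : Z = 0 := ext_iff_trace_mul_left.mpr fun K => by rw [hZ0, Matrix.mul_zero, trace_zero]
    exact (sub_eq_zero.mp this).symm
  have htr : ∀ k < qDist A, trace (A ^ k * X) = 0 := fun k hk => by
    have h1 := hgt (0, Pi.single ⟨k, hk⟩ 1)
    rw [hgX, trace_mul_comm] at h1
    simpa [orbitTangentMap, Pi.single_apply, ite_smul] using h1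
  have hX0 : X = 0 := by
    refine h X hsymm (fun i j => ?_) (fun i => hmask i i (Or.inl rfl)) hcomm htr
    by_cases hij : i = j ∨ G.Adj i j
    · rw [hmask i j hij, mul_zero]
    · rw [not_or] at hij
      rw [not_not.mp (mt (hA.2 i j hij.1).mp hij.2), zero_mul]
  refine hf0 (LinearMap.ext fun w => ?_)
  obtain ⟨Y, rfl⟩ := (nonedgePart G).surjective_rangeRestrict w
  have := hgX Y
  rw [hX0, Matrix.zero_mul, trace_zero] at this
  exact this

/-- The conjugate `e^{-(K - Kᵀ)} (M + ∑ c_k M^k) e^{K - Kᵀ}`. -/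
noncomputable def perturb {n N : ℕ}
    (x : Matrix (Fin n) (Fin n) ℝ × Matrix (Fin n) (Fin n) ℝ × (Fin N → ℝ)) :
    Matrix (Fin n) (Fin n) ℝ :=
  exp (-(x.2.1 - x.2.1ᵀ)) * (x.1 + ∑ k, x.2.2 k • x.1 ^ (k : ℕ)) * exp (x.2.1 - x.2.1ᵀ)

theorem perturb_zero {n N : ℕ} (A : Matrix (Fin n) (Fin n) ℝ) :
    perturb (N := N) (A, 0, 0) = A := by
  simp [perturb]

theorem exists_hasStrictFDerivAt_exp_conj {𝔸 : Type*} [NormedRing 𝔸] [NormedAlgebra ℝ 𝔸]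
    [CompleteSpace 𝔸] {N : ℕ} (S : 𝔸 →L[ℝ] 𝔸) (a : 𝔸) :
    ∃ D : (𝔸 × 𝔸 × (Fin N → ℝ)) →L[ℝ] 𝔸,
      HasStrictFDerivAt (fun x : 𝔸 × 𝔸 × (Fin N → ℝ) =>
        exp (-S x.2.1) * (x.1 + ∑ k, x.2.2 k • x.1 ^ (k : ℕ)) * exp (S x.2.1)) D (a, 0, 0) ∧
      ∀ h y, D (h, y) = h + (a * S y.1 - S y.1 * a + ∑ k, y.2 k • a ^ (k : ℕ)) := by
  have hexp : ∀ L : (𝔸 × 𝔸 × (Fin N → ℝ)) →L[ℝ] 𝔸, L (a, 0, 0) = 0 →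
      HasStrictFDerivAt (fun x => exp (L x)) L (a, 0, 0) := fun L hL => by
    have h := hasStrictFDerivAt_exp_zero (𝕂 := ℝ) (𝔸 := 𝔸)
    rw [← hL] at h
    exact h.comp _ L.hasStrictFDerivAt
  let L : (𝔸 × 𝔸 × (Fin N → ℝ)) →L[ℝ] 𝔸 :=
    S.comp ((ContinuousLinearMap.fst ℝ 𝔸 (Fin N → ℝ)).comp
      (ContinuousLinearMap.snd ℝ 𝔸 (𝔸 × (Fin N → ℝ))))
  let cf : Fin N → (𝔸 × 𝔸 × (Fin N → ℝ)) →L[ℝ] ℝ := fun k =>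
    (ContinuousLinearMap.proj k).comp
      ((ContinuousLinearMap.snd ℝ 𝔸 (Fin N → ℝ)).comp
        (ContinuousLinearMap.snd ℝ 𝔸 (𝔸 × (Fin N → ℝ))))
  have hpow : ∀ k : ℕ, ∃ P, HasStrictFDerivAt
      (fun x : 𝔸 × 𝔸 × (Fin N → ℝ) => x.1 ^ k) P (a, 0, 0) := fun k =>
    ⟨_, (((contDiff_fst (𝕜 := ℝ) (n := 1)).pow k).contDiffAt).hasStrictFDerivAt one_ne_zero⟩
  choose P hP using hpow
  have hpoly : HasStrictFDerivAt
      (fun x : 𝔸 × 𝔸 × (Fin N → ℝ) => x.1 + ∑ k, x.2.2 k • x.1 ^ (k : ℕ)) _ (a, 0, 0) :=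
    (hasStrictFDerivAt_fst (𝕜 := ℝ)).add
      (HasStrictFDerivAt.fun_sum fun k (_ : k ∈ Finset.univ) =>
        ((cf k).hasStrictFDerivAt (x := (a, 0, 0))).smul (hP k))
  refine ⟨_, ((hexp (-L) (by simp [L])).mul' hpoly).mul' (hexp L (by simp [L])), fun h y => ?_⟩
  simp [L, cf]
  abel

theorem exists_hasStrictFDerivAt_perturb {n N : ℕ} (A : Matrix (Fin n) (Fin n) ℝ) :
    ∃ D : (Matrix (Fin n) (Fin n) ℝ × Matrix (Fin n) (Fin n) ℝ × (Fin N → ℝ)) →L[ℝ]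
        Matrix (Fin n) (Fin n) ℝ,
      HasStrictFDerivAt perturb D (A, 0, 0) ∧
        ∀ H y, D (H, y) = H + orbitTangentMap N A y := by
  let S : Matrix (Fin n) (Fin n) ℝ →L[ℝ] Matrix (Fin n) (Fin n) ℝ :=
    LinearMap.toContinuousLinearMap
      (LinearMap.id - (transposeLinearEquiv (Fin n) (Fin n) ℝ ℝ).toLinearMap)
  obtain ⟨D, hD, hDapp⟩ := exists_hasStrictFDerivAt_exp_conj (N := N) S A
  refine ⟨D, ?_, ?_⟩
  · exact hD
  · exact hDapp

theorem continuousAt_perturb {n N : ℕ} (A : Matrix (Fin n) (Fin n) ℝ) :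
    ContinuousAt (perturb (n := n) (N := N)) (A, 0, 0) := by
  obtain ⟨D, hD, -⟩ := exists_hasStrictFDerivAt_perturb (N := N) A
  exact hD.continuousAt

theorem isSymm_perturb {n N : ℕ} {M : Matrix (Fin n) (Fin n) ℝ} (hM : M.IsSymm)
    (y : Matrix (Fin n) (Fin n) ℝ × (Fin N → ℝ)) : (perturb (M, y)).IsSymm := by
  have e1 : (y.1 - y.1ᵀ)ᵀ = -(y.1 - y.1ᵀ) := by
    rw [transpose_sub, transpose_transpose, neg_sub]
  have e2 : (M + ∑ k, y.2 k • M ^ (k : ℕ))ᵀ = M + ∑ k, y.2 k • M ^ (k : ℕ) := by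
    rw [transpose_add, transpose_sum, hM.eq]
    simp only [transpose_smul, transpose_pow, hM.eq]
  unfold perturb Matrix.IsSymm
  rw [transpose_mul, transpose_mul, e2, ← exp_transpose, ← exp_transpose, transpose_neg, e1,
    neg_neg, Matrix.mul_assoc]

/-- The polynomial `x + ∑ c_k x^k`. -/
noncomputable def perturbPoly {N : ℕ} (c : Fin N → ℝ) : ℝ[X] :=
  Polynomial.X + ∑ k, C (c k) * Polynomial.X ^ (k : ℕ)

theorem roots_charpoly_perturb {n N : ℕ} {M : Matrix (Fin n) (Fin n) ℝ} (hM : M.IsSymm)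
    (y : Matrix (Fin n) (Fin n) ℝ × (Fin N → ℝ)) :
    (perturb (M, y)).charpoly.roots = M.charpoly.roots.map (perturbPoly y.2).eval := by
  have e : aeval M (perturbPoly y.2) = M + ∑ k, y.2 k • M ^ (k : ℕ) := by
    simp [perturbPoly, Algebra.smul_def]
  have hU : exp (y.1 - y.1ᵀ) * exp (-(y.1 - y.1ᵀ)) = 1 := by
    rw [← exp_add_of_commute _ _ (Commute.refl (y.1 - y.1ᵀ)).neg_right, add_neg_cancel,
      NormedSpace.exp_zero]
  rw [← hM.roots_charpoly_aeval, e]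
  unfold perturb
  rw [charpoly_mul_comm, ← Matrix.mul_assoc, hU, Matrix.one_mul]

theorem eventually_strictMonoOn_perturbPoly {N : ℕ} (R : ℝ) :
    ∀ᶠ c : Fin N → ℝ in 𝓝 0, StrictMonoOn (perturbPoly c).eval (Set.Icc (-R) R) := by
  have key : ∀ᶠ c : Fin N → ℝ in 𝓝 0, ∀ t ∈ Set.Icc (-R) R,
      0 < 1 + ∑ k, c k * ((k : ℕ) * t ^ ((k : ℕ) - 1)) := by
    refine isCompact_Icc.eventually_forall_of_forall_eventually fun t _ => ?_
    refine ContinuousAt.eventually_mem (f := fun z : (Fin N → ℝ) × ℝ =>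
      1 + ∑ k, z.1 k * ((k : ℕ) * z.2 ^ ((k : ℕ) - 1))) (s := Set.Ioi 0) ?_ ?_
    · exact Continuous.continuousAt (by fun_prop)
    · exact Ioi_mem_nhds (by simp)
  filter_upwards [key] with c hc
  refine strictMonoOn_of_deriv_pos (convex_Icc _ _) (Polynomial.continuous _).continuousOn
    fun t ht => ?_
  rw [interior_Icc] at ht
  rw [Polynomial.deriv]
  have := hc t (Set.Ioo_subset_Icc_self ht)
  simpa [perturbPoly, eval_finsetSum, derivative_X_pow] using this

theorem abs_le_of_mem_roots_charpoly {n : ℕ} {M : Matrix (Fin n) (Fin n) ℝ} {t : ℝ}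
    (ht : t ∈ M.charpoly.roots) : |t| ≤ ‖M‖ * ‖(1 : Matrix (Fin n) (Fin n) ℝ)‖ :=
  spectrum.norm_le_norm_mul_of_mem (𝕜 := ℝ) <|
    mem_spectrum_iff_isRoot_charpoly.mpr (isRoot_of_mem_roots ht)

theorem eventually_strictMonoOn_roots {n N : ℕ} (A : Matrix (Fin n) (Fin n) ℝ) :
    ∀ᶠ x : Matrix (Fin n) (Fin n) ℝ × Matrix (Fin n) (Fin n) ℝ × (Fin N → ℝ) in 𝓝 (A, 0, 0),
      StrictMonoOn (perturbPoly x.2.2).eval {t | t ∈ x.1.charpoly.roots} := by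
  set R := (‖A‖ + 1) * ‖(1 : Matrix (Fin n) (Fin n) ℝ)‖
  have h1 : ∀ᶠ x : Matrix (Fin n) (Fin n) ℝ × Matrix (Fin n) (Fin n) ℝ × (Fin N → ℝ) in
      𝓝 (A, 0, 0), ‖x.1‖ < ‖A‖ + 1 :=
    (continuous_fst.norm.continuousAt (x := (A, 0, 0))).eventually_lt continuousAt_const
      (lt_add_one _)
  have h2 : ∀ᶠ x : Matrix (Fin n) (Fin n) ℝ × Matrix (Fin n) (Fin n) ℝ × (Fin N → ℝ) in
      𝓝 (A, 0, 0), StrictMonoOn (perturbPoly x.2.2).eval (Set.Icc (-R) R) :=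
    (continuous_snd.snd.tendsto (A, (0 : Matrix (Fin n) (Fin n) ℝ), (0 : Fin N → ℝ))).eventually
      (eventually_strictMonoOn_perturbPoly R)
  filter_upwards [h1, h2] with x hx1 hx2
  refine hx2.mono fun t ht => abs_le.mp ((abs_le_of_mem_roots_charpoly ht).trans ?_)
  exact mul_le_mul_of_nonneg_right hx1.le (norm_nonneg _)

/-- The linear conditions on `X` in the SMP of `B`, for a pattern `G` and the first `N` powers
of `B`. -/
noncomputable def smpMap {n : ℕ} (G : SimpleGraph (Fin n)) (N : ℕ)
    (B : Matrix (Fin n) (Fin n) ℝ) :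
    Matrix (Fin n) (Fin n) ℝ →ₗ[ℝ] Matrix (Fin n) (Fin n) ℝ × (Fin N → ℝ) ×
      Matrix (Fin n) (Fin n) ℝ × ({p : Fin n × Fin n // p.1 = p.2 ∨ G.Adj p.1 p.2} → ℝ) where
  toFun X := (B * X - X * B, fun k => trace (B ^ (k : ℕ) * X), X - Xᵀ, fun p => X p.1.1 p.1.2)
  map_add' X Y := by
    refine Prod.ext ?_ (Prod.ext ?_ (Prod.ext ?_ ?_))
    · simp only [Prod.fst_add]; noncomm_ring
    · ext k; simp [Matrix.mul_add]
    · simp only [Prod.snd_add, Prod.fst_add, transpose_add]; abel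
    · rfl
  map_smul' a X := by
    refine Prod.ext ?_ (Prod.ext ?_ (Prod.ext ?_ ?_))
    · simp [smul_sub]
    · ext k; simp
    · simp [smul_sub]
    · rfl

theorem smpMap_eq_zero_iff {n : ℕ} {G : SimpleGraph (Fin n)} {N : ℕ}
    {B X : Matrix (Fin n) (Fin n) ℝ} :
    smpMap G N B X = 0 ↔ B * X = X * B ∧ (∀ k < N, trace (B ^ k * X) = 0) ∧ X.IsSymm ∧
      ∀ i j, (i = j ∨ G.Adj i j) → X i j = 0 := by
  simp only [smpMap, LinearMap.coe_mk, AddHom.coe_mk, Prod.mk_eq_zero, sub_eq_zero, funext_iff,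
    Pi.zero_apply, Subtype.forall, Prod.forall, Matrix.IsSymm, eq_comm (a := X), Fin.forall_iff]

theorem isOpen_setOf_injective_of_continuous {T E F : Type*} [TopologicalSpace T]
    [NormedAddCommGroup E] [NormedSpace ℝ E] [FiniteDimensional ℝ E] [NormedAddCommGroup F]
    [NormedSpace ℝ F] (f : T → E →ₗ[ℝ] F) (hf : ∀ x, Continuous fun t => f t x) :
    IsOpen {t | Function.Injective (f t)} := by
  have hc : Continuous fun t => LinearMap.toContinuousLinearMap (f t) :=
    continuous_clm_apply.mpr hf
  exact ContinuousLinearMap.isOpen_injective.preimage hc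

theorem isOpen_setOf_injective_smpMap {n : ℕ} (G : SimpleGraph (Fin n)) (N : ℕ) :
    IsOpen {B | Function.Injective (smpMap G N B)} := by
  classical
  refine isOpen_setOf_injective_of_continuous _ fun X => ?_
  simp only [smpMap, LinearMap.coe_mk, AddHom.coe_mk]
  refine .prodMk (by fun_prop) (.prodMk ?_ continuous_const)
  exact continuous_pi fun k => ((continuous_pow _).matrix_mul continuous_const).matrix_trace

theorem HasSMP.injective_smpMap {n : ℕ} {G : SimpleGraph (Fin n)} {A : Matrix (Fin n) (Fin n) ℝ}
    (hA : sMem G A) (h : HasSMP A) : Function.Injective (smpMap G (qDist A) A) := by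
  refine (injective_iff_map_eq_zero _).mpr fun X hX => ?_
  obtain ⟨hcomm, htr, hsymm, hmask⟩ := smpMap_eq_zero_iff.mp hX
  refine h X hsymm (fun i j => ?_) (fun i => hmask i i (Or.inl rfl)) hcomm htr
  by_cases hij : i = j ∨ G.Adj i j
  · rw [hmask i j hij, mul_zero]
  · rw [not_or] at hij
    rw [not_not.mp (mt (hA.2 i j hij.1).mp hij.2), zero_mul]

theorem hasSMP_of_injective_smpMap {n : ℕ} {G : SimpleGraph (Fin n)} {N : ℕ}
    {B : Matrix (Fin n) (Fin n) ℝ} (hB : sMem G B) (h : Function.Injective (smpMap G N B)) :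
    HasSMP B := by
  intro X hsymm hmask hdiag hcomm htr
  refine (injective_iff_map_eq_zero _).mp h X (smpMap_eq_zero_iff.mpr
    ⟨hcomm, fun k _ => trace_pow_mul_eq_zero hB.1 htr k, hsymm, ?_⟩)
  rintro i j (rfl | hij)
  · exact hdiag i
  · exact (mul_eq_zero.mp (hmask i j)).resolve_left ((hB.2 i j hij.ne).mpr hij)

/-- Matrices near `A` have perturbations near `A` without entries at the nonedges of `G`. -/
theorem eventually_exists_perturb {n : ℕ} {G : SimpleGraph (Fin n)}
    {A : Matrix (Fin n) (Fin n) ℝ} (hA : sMem G A) (h : HasSMP A)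
    {P : Matrix (Fin n) (Fin n) ℝ × Matrix (Fin n) (Fin n) ℝ × (Fin (qDist A) → ℝ) → Prop}
    (hP : ∀ᶠ x in 𝓝 (A, 0, 0), P x) :
    ∀ᶠ M in 𝓝 A, ∃ y, P (M, y) ∧ nonedgePart G (perturb (M, y)) = 0 := by
  obtain ⟨D, hD, hDapp⟩ := exists_hasStrictFDerivAt_perturb (N := qDist A) A
  let π := LinearMap.toContinuousLinearMap (nonedgePart G).rangeRestrict
  have hΦ := (hasStrictFDerivAt_fst (𝕜 := ℝ) (p := (A, 0, 0))).prodMk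
    (π.hasStrictFDerivAt.comp (A, 0, 0) hD)
  have hsurj := h.range_nonedgePart_comp_orbitTangentMap hA
  have hmap := hΦ.map_nhds_eq_of_surj (by
    refine LinearMap.range_eq_top.mpr fun ⟨H, w⟩ => ?_
    obtain ⟨y, hy⟩ := LinearMap.range_eq_top.mp hsurj (w - π H)
    refine ⟨(H, y), Prod.ext rfl ?_⟩
    change π (D (H, y)) = w
    rw [hDapp, map_add]
    exact add_eq_of_eq_sub' hy)
  have hA0 : π (perturb (N := qDist A) (A, 0, 0)) = 0 := by
    rw [perturb_zero]
    refine Subtype.ext (nonedgePart_eq_zero fun i j hij hnadj => ?_)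
    rw [hA.1.apply i j, not_not.mp (mt (hA.2 i j hij).mp hnadj), add_zero]
  have hev : ∀ᶠ z in 𝓝 (A, (0 : LinearMap.range (nonedgePart G))),
      ∃ x, P x ∧ (x.1, π (perturb x)) = z := by
    have := Filter.image_mem_map (m := fun x => (x.1, π (perturb x))) hP
    erw [hmap, hA0] at this
    exact this
  have hcont : ContinuousAt (fun M : Matrix (Fin n) (Fin n) ℝ =>
      (M, (0 : LinearMap.range (nonedgePart G)))) A := by fun_prop
  filter_upwards [hcont.eventually hev] with M ⟨x, hPx, hx⟩
  obtain ⟨x, y⟩ := x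
  obtain ⟨rfl, hx2⟩ := Prod.mk.inj hx
  exact ⟨y, hPx, congrArg Subtype.val hx2⟩

theorem exists_forall_frobNorm_lt {n : ℕ} {A : Matrix (Fin n) (Fin n) ℝ}
    {P : Matrix (Fin n) (Fin n) ℝ → Prop} (h : ∀ᶠ M in 𝓝 A, P M) :
    ∃ ε > 0, ∀ M, frobNorm (M - A) < ε → P M := by
  have hmat : Continuous (fun f : Fin n → Fin n → ℝ => (of f : Matrix (Fin n) (Fin n) ℝ)) :=
    continuous_id
  have h' : ∀ᶠ f : Fin n → Fin n → ℝ in 𝓝 (of.symm A), P (of f) := hmat.tendsto _ h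
  obtain ⟨ε, hε, hball⟩ := Metric.eventually_nhds_iff.mp h'
  refine ⟨ε, hε, fun M hM => hball (y := of.symm M) ?_⟩
  refine (dist_pi_lt_iff hε).mpr fun i => (dist_pi_lt_iff hε).mpr fun j => lt_of_le_of_lt ?_ hM
  refine Real.le_sqrt_of_sq_le ?_
  rw [Real.dist_eq, sq_abs]
  have h1 := Finset.single_le_sum (f := fun j => (M - A) i j ^ 2)
    (fun j _ => sq_nonneg _) (Finset.mem_univ j)
  have h2 := Finset.single_le_sum (f := fun i => ∑ j, (M - A) i j ^ 2)
    (fun i _ => Finset.sum_nonneg fun j _ => sq_nonneg _) (Finset.mem_univ i)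
  exact h1.trans h2

/-- The conclusion of the bifurcation lemma holds in a neighborhood of `A`. -/
theorem HasSMP.eventually_exists_omlist_eq {n : ℕ} {G : SimpleGraph (Fin n)}
    {A : Matrix (Fin n) (Fin n) ℝ} (hA : sMem G A) (h : HasSMP A) :
    ∀ᶠ M in 𝓝 A, M.IsSymm → ∃ A', sMem G A' ∧ HasSMP A' ∧ omlist A' = omlist M := by
  have hpert : Filter.Tendsto perturb (𝓝 (A, (0, (0 : Fin (qDist A) → ℝ)))) (𝓝 A) := by
    have := (continuousAt_perturb (N := qDist A) A).tendsto
    rwa [perturb_zero] at this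
  have hedge : ∀ᶠ B in 𝓝 A, ∀ i j, G.Adj i j → B i j ≠ 0 := by
    refine Filter.eventually_all.mpr fun i => Filter.eventually_all.mpr fun j => ?_
    by_cases hij : G.Adj i j
    · have := (continuous_id.matrix_elem i j).continuousAt.eventually_ne
        ((hA.2 i j hij.ne).mpr hij)
      exact this.mono fun B hB _ => hB
    · exact Filter.Eventually.of_forall fun B h' => absurd h' hij
  have hinj := (isOpen_setOf_injective_smpMap G (qDist A)).mem_nhds (h.injective_smpMap hA)
  filter_upwards [eventually_exists_perturb hA h ((hpert.eventually hedge).and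
    ((hpert.eventually hinj).and (eventually_strictMonoOn_roots A)))] with M hM hsymm
  obtain ⟨y, ⟨hedge, hinj, hmono⟩, hzero⟩ := hM
  have hS := isSymm_perturb hsymm y
  have hmem : sMem G (perturb (M, y)) := by
    refine ⟨hS, fun i j hij => ⟨fun hne => ?_, hedge i j⟩⟩
    by_contra hnadj
    have := congrFun (congrFun hzero i) j
    rw [nonedgePart_apply_of_nonedge hij hnadj, hS.apply i j, Matrix.zero_apply] at this
    exact hne (by linarith)
  exact ⟨_, hmem, hasSMP_of_injective_smpMap hmem hinj,
    omlist_eq_of_roots_eq_map hmono (roots_charpoly_perturb hsymm y)⟩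

end Perturbation

/-- Bifurcation lemma for the SMP: nearby ordered multiplicity lists of symmetric
matrices are realizable in `S(G)` with the SMP. -/
theorem bifurcation_smp (n : ℕ) (G : SimpleGraph (Fin n))
    (A : Matrix (Fin n) (Fin n) ℝ) (hA : sMem G A) (hsmp : HasSMP A) :
    ∃ ε > 0, ∀ M : Matrix (Fin n) (Fin n) ℝ, M.IsSymm → frobNorm (M - A) < ε →
      ∃ A' : Matrix (Fin n) (Fin n) ℝ,
        sMem G A' ∧ HasSMP A' ∧ omlist A' = omlist M := by
  obtain ⟨ε, hε, h⟩ := exists_forall_frobNorm_lt (hsmp.eventually_exists_omlist_eq hA)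
  exact ⟨ε, hε, fun M hM hMA => h M hMA hM⟩
end

section
/- Let G be a simple graph on n vertices and let A ∈ S(G) be a matrix with the strong Arnol'd property (SAP) and rank(A) = r. Then for every integer r' with r ≤ r' ≤ n, there exists a matrix A' ∈ S(G) with the SAP and rank(A') = r'. -/
open Matrix Polynomial

/-- The strong Arnol'd property. -/
def HasSAP {n : ℕ} (A : Matrix (Fin n) (Fin n) ℝ) : Prop :=
  ∀ X : Matrix (Fin n) (Fin n) ℝ, X.IsSymm →
    (∀ i j, A i j * X i j = 0) → (∀ i, X i i = 0) → A * X = 0 → X = 0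

/-- Adding `1` to the `i`-th diagonal entry of a symmetric matrix whose kernel contains a vector
with nonzero `i`-th coordinate keeps only those kernel vectors that vanish at `i`. -/
lemma mulVec_eq_zero_of_add_single {n : ℕ} {A : Matrix (Fin n) (Fin n) ℝ} (hA : A.IsSymm)
    {u : Fin n → ℝ} (hu : A *ᵥ u = 0) {i : Fin n} (hi : u i ≠ 0) {x : Fin n → ℝ}
    (hx : (A + Matrix.single i i 1) *ᵥ x = 0) : A *ᵥ x = 0 ∧ x i = 0 := by
  have huA : u ⬝ᵥ (A *ᵥ x) = 0 := by
    rw [dotProduct_mulVec, ← mulVec_transpose, hA.eq, hu, zero_dotProduct]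
  have hs : Matrix.single i i (1 : ℝ) *ᵥ x = Pi.single i (x i) := by
    rw [single_mulVec, one_mul]
    rfl
  rw [add_mulVec, hs] at hx
  have h := congrArg (u ⬝ᵥ ·) hx
  simp only [dotProduct_add, huA, dotProduct_single, zero_add, dotProduct_zero] at h
  have hxi : x i = 0 := (mul_eq_zero.mp h).resolve_left hi
  rw [hxi, Pi.single_zero, add_zero] at hx
  exact ⟨hx, hxi⟩

/-- Such a diagonal perturbation raises the rank by exactly one. -/
lemma rank_add_single {n : ℕ} {A : Matrix (Fin n) (Fin n) ℝ} (hA : A.IsSymm)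
    {u : Fin n → ℝ} (hu : A *ᵥ u = 0) {i : Fin n} (hi : u i ≠ 0) :
    (A + Matrix.single i i 1).rank = A.rank + 1 := by
  apply le_antisymm
  · have hone : (Matrix.single i i (1 : ℝ)).rank ≤ 1 := by
      rw [single_eq_single_vecMulVec_single]
      exact rank_vecMulVec_le _ _
    have hrange : LinearMap.range (A + Matrix.single i i 1).mulVecLin ≤
        LinearMap.range A.mulVecLin ⊔ LinearMap.range (Matrix.single i i (1 : ℝ)).mulVecLin := by
      rintro _ ⟨x, rfl⟩
      rw [mulVecLin_add]
      exact Submodule.add_mem_sup ⟨x, rfl⟩ ⟨x, rfl⟩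
    exact (Submodule.finrank_mono hrange).trans <|
      (Submodule.finrank_add_le_finrank_add_finrank _ _).trans (Nat.add_le_add_left hone _)
  · have hlt : LinearMap.ker (A + Matrix.single i i 1).mulVecLin < LinearMap.ker A.mulVecLin := by
      refine lt_of_le_of_ne (fun x hx => (mulVec_eq_zero_of_add_single hA hu hi hx).1) fun h => ?_
      have hmem : u ∈ LinearMap.ker (A + Matrix.single i i 1).mulVecLin := h ▸ hu
      exact hi (mulVec_eq_zero_of_add_single hA hu hi hmem).2
    have hfin := Submodule.finrank_lt_finrank_of_lt hlt
    have h₁ := A.mulVecLin.finrank_range_add_finrank_ker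
    have h₂ := (A + Matrix.single i i 1).mulVecLin.finrank_range_add_finrank_ker
    unfold Matrix.rank
    omega

/-- A matrix in `S(G)` with the SAP that is not of full rank can be replaced by one whose rank is
larger by one. -/
lemma exists_sap_rank_succ {n : ℕ} {G : SimpleGraph (Fin n)} {A : Matrix (Fin n) (Fin n) ℝ}
    (hA : sMem G A) (hsap : HasSAP A) (hr : A.rank < n) :
    ∃ A' : Matrix (Fin n) (Fin n) ℝ, sMem G A' ∧ HasSAP A' ∧ A'.rank = A.rank + 1 := by
  obtain ⟨u, hu0, hu⟩ : ∃ u, u ≠ 0 ∧ A *ᵥ u = 0 := by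
    rw [exists_mulVec_eq_zero_iff]
    by_contra hdet
    have h := rank_of_isUnit A ((isUnit_iff_isUnit_det A).2 (isUnit_iff_ne_zero.2 hdet))
    rw [Fintype.card_fin] at h
    omega
  obtain ⟨i, hi⟩ := Function.ne_iff.mp hu0
  have hoff : ∀ j k, j ≠ k → (A + Matrix.single i i (1 : ℝ)) j k = A j k := by
    intro j k hjk
    rw [Matrix.add_apply,
      single_apply_of_ne _ _ _ _ _ (by rintro ⟨rfl, rfl⟩; exact hjk rfl), add_zero]
  refine ⟨A + Matrix.single i i 1, ⟨?_, ?_⟩, ?_, rank_add_single hA.1 hu hi⟩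
  · exact hA.1.add (transpose_single _ _ _)
  · intro j k hjk
    rw [hoff j k hjk]
    exact hA.2 j k hjk
  · intro X hX hAX hdiag hmul
    refine hsap X hX (fun j k => ?_) hdiag ?_
    · rcases eq_or_ne j k with rfl | hjk
      · rw [hdiag, mul_zero]
      · rw [← hoff j k hjk]
        exact hAX j k
    · ext j k
      have hcol : (A + Matrix.single i i 1) *ᵥ X.col k = 0 := by
        ext l
        exact congrFun (congrFun hmul l) k
      exact congrFun (mulVec_eq_zero_of_add_single hA.1 hu hi hcol).1 j

/-- Corollary 8: if `A ∈ S(G)` has the SAP and rank `r`, then every rank `r'` with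
`r ≤ r' ≤ n` is realized by a matrix in `S(G)` with the SAP. -/
theorem bifurcation_sap_rank (n : ℕ) (G : SimpleGraph (Fin n))
    (A : Matrix (Fin n) (Fin n) ℝ) (hA : sMem G A) (hsap : HasSAP A)
    (r : ℕ) (hr : A.rank = r) :
    ∀ r' : ℕ, r ≤ r' → r' ≤ n →
      ∃ A' : Matrix (Fin n) (Fin n) ℝ, sMem G A' ∧ HasSAP A' ∧ A'.rank = r' := by
  intro r' hrr'
  induction r', hrr' using Nat.le_induction with
  | base => exact fun _ => ⟨A, hA, hsap, hr⟩
  | succ k _ ih =>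
    intro hk
    obtain ⟨B, hB, hBsap, rfl⟩ := ih (by omega)
    exact exists_sap_rank_succ hB hBsap hk
end
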